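/- On every finite-dimensional U_q(sl2)-module, the operators π(s) (the shifted extremal projector) and its image σ(π(s)) under the Chevalley involution σ (e ↔ f, h ↦ −h) are related by σ(π(s)) = q^{-h} · ([s]_q/[s+h]_q) · π(h+s), as an identity of linear operators on each weight subspace where the coefficients are defined. -/

import Mathlib

open Finset

noncomputable section

/-- `(u - u⁻¹)/(q - q⁻¹)`; with `u = q^z` this is the q-number `[z]_q`. -/
def qNum (q u : ℂ) : ℂ := (u - u⁻¹) / (q - q⁻¹)

/-- q-factorial `[k]_q!`. -/
def qFact (q : ℂ) (k : ℕ) : ℂ := ∏ i ∈ Finset.range k, qNum q (q ^ (i + 1))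

open Polynomial in
/-- If the roots of a product of distinct linear factors that are also roots of `P` are roots
of `D`, then `D` kills every vector killed by both. -/
lemma aeval_apply_eq_zero_of_common_roots {V : Type*} [AddCommGroup V] [Module ℂ V]
    (A : Module.End ℂ V) (v : V) (P Q D : ℂ[X]) (hQ0 : Q ≠ 0) (hQ : Q.roots.Nodup)
    (hP : aeval A P v = 0) (hQv : aeval A Q v = 0)
    (hD : ∀ r, P.IsRoot r → Q.IsRoot r → D.IsRoot r) : aeval A D v = 0 := by
  classical
  by_cases hD0 : D = 0
  · simp [hD0]
  set G := EuclideanDomain.gcd P Q with hG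
  have hGQ : G ∣ Q := EuclideanDomain.gcd_dvd_right P Q
  have hGP : G ∣ P := EuclideanDomain.gcd_dvd_left P Q
  have hGD : G ∣ D := by
    have hG0 : G ≠ 0 := ne_zero_of_dvd_ne_zero hQ0 hGQ
    refine (IsAlgClosed.splits G).dvd_of_roots_le_roots hG0 ?_
    rw [Multiset.le_iff_subset (Multiset.nodup_of_le (roots.le_of_dvd hQ0 hGQ) hQ)]
    intro r hr
    have hr' : G.IsRoot r := (mem_roots hG0).1 hr
    exact (mem_roots hD0).2 (hD r (hr'.dvd hGP) (hr'.dvd hGQ))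
  obtain ⟨R, hR⟩ := hGD
  rw [hR, hG, EuclideanDomain.gcd_eq_gcd_ab P Q]
  have key : (P * EuclideanDomain.gcdA P Q + Q * EuclideanDomain.gcdB P Q) * R
      = (EuclideanDomain.gcdA P Q * R) * P + (EuclideanDomain.gcdB P Q * R) * Q := by ring
  rw [key]
  simp [hP, hQv]

lemma sub_inv_ne_zero_of_generic {q : ℂ} (hq0 : q ≠ 0) (hq : ∀ n : ℕ, 0 < n → q ^ n ≠ 1) :
    q - q⁻¹ ≠ 0 := by
  intro h
  apply hq 2 (by norm_num)
  field_simp at h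
  linear_combination h

lemma zpow_ne_one_of_generic {q : ℂ} (hq : ∀ n : ℕ, 0 < n → q ^ n ≠ 1) {z : ℤ} (hz : z ≠ 0) :
    q ^ z ≠ 1 := by
  obtain ⟨n, rfl | rfl⟩ := z.eq_nat_or_neg
  · simpa using hq n (by omega)
  · simpa using hq n (by omega)

lemma qNum_zpow_ne_zero {q : ℂ} (hq0 : q ≠ 0) (hq : ∀ n : ℕ, 0 < n → q ^ n ≠ 1) {z : ℤ}
    (hz : z ≠ 0) : qNum q (q ^ z) ≠ 0 := by
  refine div_ne_zero (fun h => ?_) (sub_inv_ne_zero_of_generic hq0 hq)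
  apply zpow_ne_one_of_generic hq (z := z + z) (by omega)
  have hz0 : q ^ z ≠ 0 := zpow_ne_zero _ hq0
  rw [zpow_add₀ hq0]
  field_simp at h
  linear_combination h

lemma qNum_pow_succ_ne_zero {q : ℂ} (hq0 : q ≠ 0) (hq : ∀ n : ℕ, 0 < n → q ^ n ≠ 1) (k : ℕ) :
    qNum q (q ^ (k + 1)) ≠ 0 := by
  have := qNum_zpow_ne_zero hq0 hq (z := (k : ℤ) + 1) (by omega)
  exact_mod_cast this

lemma qFact_ne_zero {q : ℂ} (hq0 : q ≠ 0) (hq : ∀ n : ℕ, 0 < n → q ^ n ≠ 1) (k : ℕ) :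
    qFact q k ≠ 0 :=
  prod_ne_zero_iff.2 fun i _ => qNum_pow_succ_ne_zero hq0 hq i

/-- `[x + y] = y⁻¹ [x] + x [y]` in multiplicative notation. -/
lemma qNum_mul (q : ℂ) {x y : ℂ} (hx : x ≠ 0) (hy : y ≠ 0) :
    qNum q (x * y) = y⁻¹ * qNum q x + x * qNum q y := by
  have : x * y - (x * y)⁻¹ = y⁻¹ * (x - x⁻¹) + x * (y - y⁻¹) := by
    field_simp
    ring
  simp only [qNum, this]
  ring

/-- The `k`-th term of the terminating `q`-hypergeometric sum in `qChuVandermonde`. -/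
def qVandermondeTerm (q b c : ℂ) (n k : ℕ) : ℂ :=
  (-1) ^ k * (c / b * q ^ ((n : ℤ) - 1)) ^ k /
      (qFact q k * ∏ i ∈ range k, qNum q (c * q ^ i)) *
    ∏ l ∈ range k, (qNum q (q ^ ((n : ℤ) - l)) * qNum q (b * q ^ l))

lemma qVandermondeTerm_eq_zero (q b c : ℂ) {n k : ℕ} (h : n < k) :
    qVandermondeTerm q b c n k = 0 := by
  have h0 : ∏ l ∈ range k, (qNum q (q ^ ((n : ℤ) - l)) * qNum q (b * q ^ l)) = 0 :=
    prod_eq_zero (mem_range.2 h) (by simp [qNum])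
  rw [qVandermondeTerm, h0, mul_zero]

lemma prod_qNum_succ_shift (q : ℂ) (n k : ℕ) :
    ∏ l ∈ range (k + 1), qNum q (q ^ (((n + 1 : ℕ) : ℤ) - l)) =
      (∏ l ∈ range k, qNum q (q ^ ((n : ℤ) - l))) * qNum q (q ^ ((n : ℤ) + 1)) := by
  rw [prod_range_succ']
  congr 1
  refine prod_congr rfl fun l _ => ?_
  congr 2
  push_cast
  ring

lemma qVandermondeTerm_succ_succ {q : ℂ} (hq0 : q ≠ 0) (hq : ∀ n : ℕ, 0 < n → q ^ n ≠ 1)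
    {b c : ℂ} (hb : b ≠ 0) (n k : ℕ) :
    qVandermondeTerm q b c (n + 1) (k + 1) = qVandermondeTerm q b c n (k + 1) -
      c / b * q ^ (2 * n) * (qNum q b / qNum q c) *
        qVandermondeTerm q (b * q) (c * q) n k := by
  have hk := qNum_pow_succ_ne_zero hq0 hq k
  have hf := qFact_ne_zero hq0 hq k
  have hpascal : qNum q (q ^ ((n : ℤ) + 1)) =
      (q ^ (k + 1))⁻¹ * qNum q (q ^ ((n : ℤ) - k)) +
        q ^ ((n : ℤ) - k) * qNum q (q ^ (k + 1)) := by
    rw [← qNum_mul q (zpow_ne_zero _ hq0) (pow_ne_zero _ hq0), ← zpow_natCast q (k + 1),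
      ← zpow_add₀ hq0]
    congr 2
    push_cast
    ring
  have hfs : qFact q (k + 1) = qFact q k * qNum q (q ^ (k + 1)) := prod_range_succ _ _
  have hshift (x : ℂ) : ∏ i ∈ range (k + 1), qNum q (x * q ^ i) =
      (∏ i ∈ range k, qNum q (x * q * q ^ i)) * qNum q x := by
    rw [prod_range_succ']
    simp [pow_succ', mul_assoc]
  have hcb : c * q / (b * q) = c / b := by field_simp
  unfold qVandermondeTerm
  simp only [prod_mul_distrib]
  rw [prod_qNum_succ_shift, hpascal, hfs, hshift, hshift, hcb,
    prod_range_succ (fun l : ℕ => qNum q (q ^ ((n : ℤ) - l)))]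
  have e1 : q ^ (((n + 1 : ℕ) : ℤ) - 1) = q ^ n := by
    rw [← zpow_natCast]; congr 1; push_cast; ring
  have e2 : q ^ ((n : ℤ) - 1) = q ^ n / q := by rw [zpow_sub₀ hq0]; simp
  have e3 : q ^ ((n : ℤ) - k) = q ^ n / q ^ k := by rw [zpow_sub₀ hq0]; simp
  rw [e1, e2]
  generalize qNum q (q ^ ((n : ℤ) - k)) = X
  rw [e3]
  generalize ∏ l ∈ range k, qNum q (q ^ ((n : ℤ) - l)) = Y
  generalize ∏ l ∈ range k, qNum q (b * q * q ^ l) = B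
  simp only [div_eq_mul_inv, mul_inv]
  generalize (∏ l ∈ range k, qNum q (c * q * q ^ l))⁻¹ = Z
  generalize (qNum q c)⁻¹ = W
  generalize qNum q b = U
  generalize qNum q (q ^ (k + 1)) = S at *
  generalize qFact q k = T at *
  simp only [mul_pow, inv_pow]
  field_simp
  ring

/-- The `q`-Chu–Vandermonde summation, in terms of symmetric `q`-numbers. -/
lemma qChuVandermonde {q : ℂ} (hq0 : q ≠ 0) (hq : ∀ n : ℕ, 0 < n → q ^ n ≠ 1) (n : ℕ) :
    ∀ {b c : ℂ}, b ≠ 0 → c ≠ 0 → (∀ i < n, qNum q (c * q ^ i) ≠ 0) →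
    ∑ k ∈ range (n + 1), qVandermondeTerm q b c n k =
      (b ^ n)⁻¹ * ((∏ i ∈ range n, qNum q (c / b * q ^ i)) /
        ∏ i ∈ range n, qNum q (c * q ^ i)) := by
  induction n with
  | zero => intro b c _ _ _; simp [qVandermondeTerm, qFact]
  | succ n ih =>
    intro b c hb hc hden
    have h0 : qVandermondeTerm q b c (n + 1) 0 = qVandermondeTerm q b c n 0 := by
      simp [qVandermondeTerm]
    have hden' : ∀ i < n, qNum q (c * q * q ^ i) ≠ 0 := fun i hi => by
      simpa [pow_succ', mul_assoc] using hden (i + 1) (by omega)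
    have hcb : c * q / (b * q) = c / b := by field_simp
    rw [sum_range_succ', h0]
    simp only [qVandermondeTerm_succ_succ hq0 hq hb]
    rw [sum_sub_distrib, ← mul_sum, sub_add_eq_add_sub, ← sum_range_succ', sum_range_succ,
      qVandermondeTerm_eq_zero q b c (Nat.lt_succ_self n), add_zero,
      ih hb hc fun i hi => hden i (by omega),
      ih (mul_ne_zero hb hq0) (mul_ne_zero hc hq0) hden', hcb]
    have hsplit : (∏ i ∈ range n, qNum q (c * q ^ i)) * qNum q (c * q ^ n) =
        (∏ i ∈ range n, qNum q (c * q * q ^ i)) * qNum q c := by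
      rw [← prod_range_succ, prod_range_succ']
      simp [pow_succ', mul_assoc]
    have hrec : qNum q (c * q ^ n) =
        b⁻¹ * qNum q (c / b * q ^ n) + c / b * q ^ n * qNum q b := by
      rw [← qNum_mul q (by positivity) hb]
      congr 1
      field_simp
    have h1 : ∏ i ∈ range n, qNum q (c * q ^ i) ≠ 0 :=
      prod_ne_zero_iff.2 fun i hi => hden i (by have := mem_range.1 hi; omega)
    have h2 : ∏ i ∈ range n, qNum q (c * q * q ^ i) ≠ 0 :=
      prod_ne_zero_iff.2 fun i hi => hden' i (mem_range.1 hi)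
    have h3 : qNum q (c * q ^ n) ≠ 0 := hden n (by omega)
    have h4 : qNum q c ≠ 0 := by simpa using hden 0 (by omega)
    rw [prod_range_succ, prod_range_succ (fun i => qNum q (c * q ^ i))]
    have hdiv : (qNum q c)⁻¹ * (∏ i ∈ range n, qNum q (c * q * q ^ i))⁻¹ =
        (∏ i ∈ range n, qNum q (c * q ^ i))⁻¹ * (qNum q (c * q ^ n))⁻¹ := by
      rw [← mul_inv, ← mul_inv, hsplit, mul_comm]
    have hlhs : ∀ Pr : ℂ, c / b * q ^ (2 * n) * (qNum q b / qNum q c) *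
        (((b * q) ^ n)⁻¹ * (Pr / ∏ i ∈ range n, qNum q (c * q * q ^ i))) =
        c / b * q ^ (2 * n) * qNum q b * ((b * q) ^ n)⁻¹ * Pr *
        ((∏ i ∈ range n, qNum q (c * q ^ i))⁻¹ * (qNum q (c * q ^ n))⁻¹) := by
      intro Pr
      rw [← hdiv]
      ring
    rw [hlhs]
    have hrec' : qNum q (c / b * q ^ n) =
        b * (qNum q (c * q ^ n) - c / b * q ^ n * qNum q b) := by
      rw [hrec]
      field_simp
      ring
    rw [hrec']
    generalize qNum q (c * q ^ n) = S at *
    generalize (∏ i ∈ range n, qNum q (c * q ^ i)) = T at *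
    generalize (∏ i ∈ range n, qNum q (c / b * q ^ i)) = R at *
    field_simp
    ring

/-- Eigenvalue of the quantum Casimir on the simple module of highest weight `n - 1`. -/
def casimirValue (q : ℂ) (n : ℤ) : ℂ := (q ^ n + q ^ (-n)) / (q - q⁻¹) ^ 2

lemma casimirValue_neg (q : ℂ) (n : ℤ) : casimirValue q (-n) = casimirValue q n := by
  simp [casimirValue, add_comm]

lemma casimirValue_add_sub {q : ℂ} (hq0 : q ≠ 0) (x y : ℤ) :
    casimirValue q (x + y) - casimirValue q (x - y) = qNum q (q ^ x) * qNum q (q ^ y) := by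
  have hx : q ^ x ≠ 0 := zpow_ne_zero _ hq0
  have hy : q ^ y ≠ 0 := zpow_ne_zero _ hq0
  simp only [casimirValue, qNum, zpow_neg, zpow_add₀ hq0, zpow_sub₀ hq0]
  rw [div_sub_div_same, div_mul_div_comm, ← sq]
  congr 1
  field_simp
  ring

lemma casimirValue_eq_iff {q : ℂ} (hq0 : q ≠ 0) (hq : ∀ n : ℕ, 0 < n → q ^ n ≠ 1) {a b : ℤ}
    (h : casimirValue q a = casimirValue q b) : a = b ∨ a = -b := by
  by_contra! hab
  have hs := sub_inv_ne_zero_of_generic hq0 hq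
  have h1 : q ^ (a - b) ≠ 1 := zpow_ne_one_of_generic hq (by omega)
  have h2 : q ^ (a + b) ≠ 1 := zpow_ne_one_of_generic hq (by omega)
  have ha : q ^ a ≠ 0 := zpow_ne_zero _ hq0
  have hb : q ^ b ≠ 0 := zpow_ne_zero _ hq0
  rw [zpow_sub₀ hq0] at h1
  rw [zpow_add₀ hq0] at h2
  apply mul_ne_zero (sub_ne_zero.2 h1) (sub_ne_zero.2 h2)
  simp only [casimirValue, zpow_neg] at h
  rw [div_left_inj' (pow_ne_zero 2 hs)] at h
  field_simp at h ⊢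
  linear_combination h

/-- The identity between the two extremal projectors on the weight space of weight `n - j` of
the simple module of highest weight `n + j`. -/
lemma sum_qVandermondeTerm_swap {q t : ℂ} (hq0 : q ≠ 0) (hq : ∀ n : ℕ, 0 < n → q ^ n ≠ 1)
    (ht : t ≠ 0) (n j : ℕ)
    (h1 : ∀ i < n, qNum q (t * q * q ^ i) ≠ 0)
    (h2 : ∀ i < j + 1, qNum q (t * q ^ ((n : ℤ) - j) * q ^ i) ≠ 0) :
    ∑ k ∈ range (n + 1), qVandermondeTerm q (q ^ (j + 1)) (t * q) n k =
      q ^ (-((n : ℤ) - j)) * qNum q t / qNum q (t * q ^ ((n : ℤ) - j)) *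
        ∑ k ∈ range (j + 1),
          qVandermondeTerm q (q ^ (n + 1)) (t * q ^ ((n : ℤ) - j) * q) j k := by
  have hm : q ^ ((n : ℤ) - j) = q ^ n / q ^ j := by rw [zpow_sub₀ hq0]; simp
  have h2' : ∀ i < j, qNum q (t * q ^ ((n : ℤ) - j) * q * q ^ i) ≠ 0 := fun i hi => by
    simpa [pow_succ', mul_assoc] using h2 (i + 1) (by omega)
  have h20 : qNum q (t * q ^ ((n : ℤ) - j)) ≠ 0 := by simpa using h2 0 (by omega)
  rw [qChuVandermonde hq0 hq n (by positivity) (by positivity) h1,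
    qChuVandermonde hq0 hq j (by positivity) (by positivity) h2']
  have hT1 : ∏ i ∈ range (n + (j + 1)), qNum q (t / q ^ j * q ^ i) =
      (∏ i ∈ range n, qNum q (t * q / q ^ (j + 1) * q ^ i)) *
        (qNum q (t * q ^ ((n : ℤ) - j)) *
          ∏ i ∈ range j, qNum q (t * q ^ ((n : ℤ) - j) * q * q ^ i)) := by
    rw [prod_range_add, prod_range_succ']
    congr 1
    · refine prod_congr rfl fun i _ => ?_
      congr 1
      rw [pow_succ]
      field_simp
    · rw [mul_comm]
      congr 1
      · congr 1
        rw [hm]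
        simp only [add_zero]
        ring
      · refine prod_congr rfl fun i _ => ?_
        congr 1
        rw [hm]
        ring
  have hT2 : ∏ i ∈ range (j + (n + 1)), qNum q (t / q ^ j * q ^ i) =
      (∏ i ∈ range j, qNum q (t * q ^ ((n : ℤ) - j) * q / q ^ (n + 1) * q ^ i)) *
        (qNum q t * ∏ i ∈ range n, qNum q (t * q * q ^ i)) := by
    rw [prod_range_add, prod_range_succ']
    congr 1
    · refine prod_congr rfl fun i _ => ?_
      congr 1
      rw [hm, pow_succ]
      field_simp
    · rw [mul_comm]
      congr 1
      · congr 1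
        simp only [add_zero]
        field_simp
      · refine prod_congr rfl fun i _ => ?_
        congr 1
        rw [pow_add, pow_add]
        field_simp
  have hT : n + (j + 1) = j + (n + 1) := by ring
  rw [hT, hT2] at hT1
  have hD1 : ∏ i ∈ range n, qNum q (t * q * q ^ i) ≠ 0 :=
    prod_ne_zero_iff.2 fun i hi => h1 i (mem_range.1 hi)
  have hD2 : ∏ i ∈ range j, qNum q (t * q ^ ((n : ℤ) - j) * q * q ^ i) ≠ 0 :=
    prod_ne_zero_iff.2 fun i hi => h2' i (mem_range.1 hi)
  have hpow : ((q ^ (j + 1)) ^ n)⁻¹ = q ^ (-((n : ℤ) - j)) * ((q ^ (n + 1)) ^ j)⁻¹ := by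
    rw [zpow_neg, hm]
    field_simp
    ring
  rw [hpow]
  generalize q ^ (-((n : ℤ) - j)) = p
  generalize ∏ i ∈ range n, qNum q (t * q * q ^ i) = D1 at *
  generalize ∏ i ∈ range j, qNum q (t * q ^ ((n : ℤ) - j) * q * q ^ i) = D2 at *
  generalize qNum q (t * q ^ ((n : ℤ) - j)) = D3 at *
  generalize ∏ i ∈ range n, qNum q (t * q / q ^ (j + 1) * q ^ i) = A1 at *
  generalize ∏ i ∈ range j, qNum q (t * q ^ ((n : ℤ) - j) * q / q ^ (n + 1) * q ^ i) = A2 at *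
  field_simp
  linear_combination -p * hT1

section Casimir

open Polynomial

variable {V : Type*} [AddCommGroup V] [Module ℂ V]

/-- The quantum Casimir operator. -/
def qCasimir (q : ℂ) (E F K Ki : Module.End ℂ V) : Module.End ℂ V :=
  F * E + ((q - q⁻¹) ^ 2)⁻¹ • (q • K + q⁻¹ • Ki)

/-- The polynomial in the quantum Casimir by which `F ^ k * E ^ k` (for `ε = 1`), respectively
`E ^ k * F ^ k` (for `ε = -1`), acts on weight `m`. -/
def casimirPoly (q : ℂ) (m ε : ℤ) (k : ℕ) : ℂ[X] :=
  ∏ j ∈ range k, (X - C (casimirValue q (m + ε * (2 * j + 1))))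

lemma casimirPoly_isRoot_iff (q : ℂ) (m ε : ℤ) (k : ℕ) (r : ℂ) :
    (casimirPoly q m ε k).IsRoot r ↔ ∃ j < k, r = casimirValue q (m + ε * (2 * j + 1)) := by
  simp [casimirPoly, IsRoot, eval_prod, prod_eq_zero_iff, sub_eq_zero]

lemma casimirPoly_ne_zero (q : ℂ) (m ε : ℤ) (k : ℕ) : casimirPoly q m ε k ≠ 0 :=
  prod_ne_zero_iff.2 fun _ _ => X_sub_C_ne_zero _

lemma casimirPoly_roots_nodup {q : ℂ} (hq0 : q ≠ 0) (hq : ∀ n : ℕ, 0 < n → q ^ n ≠ 1)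
    {m ε : ℤ} (hε : ε = 1 ∧ 0 ≤ m ∨ ε = -1 ∧ m ≤ 0) (k : ℕ) :
    (casimirPoly q m ε k).roots.Nodup := by
  have hr : (casimirPoly q m ε k).roots =
      (range k).val.map fun j : ℕ => casimirValue q (m + ε * (2 * j + 1)) := by
    rw [← roots_multiset_prod_X_sub_C (Multiset.map _ _), Multiset.map_map]
    rfl
  rw [hr]
  refine Multiset.Nodup.map_on (fun i _ j _ hij => ?_) (range k).nodup
  rcases hε with ⟨rfl, hm⟩ | ⟨rfl, hm⟩ <;>
    rcases casimirValue_eq_iff hq0 hq hij with h | h <;> omega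

lemma weight_raise {q : ℂ} (hq0 : q ≠ 0) {K E : Module.End ℂ V} {ε : ℤ}
    (hKE : K * E = (q ^ (2 * ε)) • (E * K)) {v : V} {m : ℤ} (hKv : K v = q ^ m • v) (k : ℕ) :
    K ((E ^ k) v) = q ^ (m + 2 * ε * k) • (E ^ k) v := by
  induction k with
  | zero => simpa using hKv
  | succ k ih =>
    have h := LinearMap.congr_fun hKE ((E ^ k) v)
    simp only [Module.End.mul_apply, LinearMap.smul_apply, ih, map_smul, smul_smul] at h
    rw [pow_succ', Module.End.mul_apply, h, ← zpow_add₀ hq0]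
    congr 2
    push_cast
    ring

lemma weight_inv {q : ℂ} (hq0 : q ≠ 0) {K Ki : Module.End ℂ V} (hKi : Ki * K = 1) {w : V}
    {m : ℤ} (hw : K w = q ^ m • w) : Ki w = q ^ (-m) • w := by
  have h : Ki (K w) = w := LinearMap.congr_fun hKi w
  rw [hw, map_smul] at h
  rw [zpow_neg]
  exact (inv_smul_eq_iff₀ (zpow_ne_zero _ hq0)).2 h.symm |>.symm

lemma qCasimir_apply_weight {q : ℂ} (hq0 : q ≠ 0) {E F K Ki : Module.End ℂ V}
    (hKi : Ki * K = 1) {w : V} {m : ℤ} (hw : K w = q ^ m • w) :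
    F (E w) = qCasimir q E F K Ki w - casimirValue q (m + 1) • w := by
  have h1 : casimirValue q (m + 1) = ((q - q⁻¹) ^ 2)⁻¹ * (q * q ^ m + q⁻¹ * q ^ (-m)) := by
    rw [casimirValue, neg_add, zpow_add₀ hq0, zpow_add₀ hq0]
    simp only [zpow_neg, zpow_one]
    ring
  simp only [qCasimir, LinearMap.add_apply, Module.End.mul_apply, LinearMap.smul_apply, hw,
    weight_inv hq0 hKi hw, h1]
  module

lemma qCasimir_apply_weight' {q : ℂ} (hq0 : q ≠ 0) (hs : q - q⁻¹ ≠ 0)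
    {E F K Ki : Module.End ℂ V}
    (hKi : Ki * K = 1) (hEF : E * F - F * E = (q - q⁻¹)⁻¹ • (K - Ki))
    {w : V} {m : ℤ} (hw : K w = q ^ m • w) :
    E (F w) = qCasimir q E F K Ki w - casimirValue q (m - 1) • w := by
  have h := LinearMap.congr_fun hEF w
  simp only [LinearMap.sub_apply, Module.End.mul_apply, LinearMap.smul_apply, hw,
    weight_inv hq0 hKi hw, sub_eq_iff_eq_add] at h
  rw [h, qCasimir_apply_weight hq0 hKi hw]
  have h1 : casimirValue q (m + 1) - casimirValue q (m - 1) =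
      (q - q⁻¹)⁻¹ * (q ^ m - q ^ (-m)) := by
    rw [casimirValue_add_sub hq0, qNum, qNum, zpow_one, zpow_neg, div_self hs]
    ring
  rw [eq_add_of_sub_eq h1]
  module

lemma qCasimir_commute {q : ℂ} (hq0 : q ≠ 0) {E F K Ki : Module.End ℂ V}
    (hK : K * Ki = 1) (hKi : Ki * K = 1)
    (hKE : K * E = (q ^ 2) • (E * K)) (hKF : K * F = (q ^ 2)⁻¹ • (F * K))
    (hEF : E * F - F * E = (q - q⁻¹)⁻¹ • (K - Ki)) :
    Commute (qCasimir q E F K Ki) E ∧ Commute (qCasimir q E F K Ki) F := by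
  have hq2 : q ^ 2 ≠ 0 := pow_ne_zero _ hq0
  have hKiE : E * Ki = (q ^ 2) • (Ki * E) := by
    calc E * Ki = Ki * (K * E) * Ki := by rw [← mul_assoc, hKi, one_mul]
      _ = (q ^ 2) • (Ki * E) := by
        rw [hKE, mul_smul_comm, smul_mul_assoc, mul_assoc, mul_assoc, hK, mul_one]
  have hKiF : F * Ki = (q ^ 2)⁻¹ • (Ki * F) := by
    calc F * Ki = Ki * (K * F) * Ki := by rw [← mul_assoc, hKi, one_mul]
      _ = (q ^ 2)⁻¹ • (Ki * F) := by
        rw [hKF, mul_smul_comm, smul_mul_assoc, mul_assoc, mul_assoc, hK, mul_one]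
  rw [sub_eq_iff_eq_add] at hEF
  have hKE' : E * K = (q ^ 2)⁻¹ • (K * E) := by rw [hKE, inv_smul_smul₀ hq2]
  have hKF' : F * K = (q ^ 2) • (K * F) := by rw [hKF, smul_inv_smul₀ hq2]
  constructor
  · rw [commute_iff_eq]
    simp only [qCasimir, add_mul, mul_add, smul_add, smul_mul_assoc, mul_smul_comm,
      ← mul_assoc, hEF, sub_mul, hKE', hKiE, smul_sub, smul_smul]
    match_scalars <;> field_simp <;> ring
  · rw [commute_iff_eq]
    have hFEF : F * E * F = F * F * E + (q - q⁻¹)⁻¹ • (F * K - F * Ki) := by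
      rw [mul_assoc, hEF, mul_add, mul_smul_comm, mul_sub, ← mul_assoc, add_comm]
    simp only [qCasimir, add_mul, mul_add, smul_add, smul_mul_assoc, mul_smul_comm,
      ← mul_assoc, hFEF, hKF', hKiF, smul_sub, smul_smul]
    match_scalars <;> field_simp <;> ring

/-- If `B * A` acts on each weight space by the shifted Casimir `Z`, then `B ^ k * A ^ k` acts
on weight vectors by a polynomial in `Z`. -/
lemma pow_pow_apply_eq_aeval {q : ℂ} {A B Z : Module.End ℂ V} {ε m : ℤ} {v : V}
    (hB : Commute Z B)
    (hstep : ∀ k : ℕ, B (A ((A ^ k) v)) =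
      Z ((A ^ k) v) - casimirValue q (m + ε * (2 * k + 1)) • (A ^ k) v) (k : ℕ) :
    (B ^ k) ((A ^ k) v) = aeval Z (casimirPoly q m ε k) v := by
  induction k with
  | zero => simp [casimirPoly]
  | succ k ih =>
    have hc : (B ^ k) (Z ((A ^ k) v)) = Z ((B ^ k) ((A ^ k) v)) :=
      (LinearMap.congr_fun (hB.pow_right k) ((A ^ k) v)).symm
    have hp : casimirPoly q m ε (k + 1) =
        (X - C (casimirValue q (m + ε * (2 * k + 1)))) * casimirPoly q m ε k := by
      rw [casimirPoly, prod_range_succ, mul_comm]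
      rfl
    rw [pow_succ, Module.End.mul_apply, pow_succ' A, Module.End.mul_apply, hstep, map_sub,
      map_smul, hc, ih, hp, map_mul, Module.End.mul_apply]
    simp [Module.algebraMap_end_apply]

end Casimir

/-- on a finite-dimensional `U_q(sl2)`-module the Chevalley image
`σ(π(s)) = ∑_k e^k f^k (-1)^k q^{k(s+h-1)}/([k]_q! ∏ [s+i]_q)` of the shifted extremal
projector satisfies `σ(π(s)) = q^{-h}·([s]_q/[s+h]_q)·π(h+s)`, evaluated on a weight
vector `v` of integer weight `m` (so `K v = q^m • v`, `E`, `F` act nilpotently on `v`;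
`t = q^s`, and all the `h`-dependent scalars are evaluated at the weight `m`). -/
theorem sigma_pi_relation {V : Type*} [AddCommGroup V] [Module ℂ V]
    (q t : ℂ) (hq0 : q ≠ 0) (hq : ∀ n : ℕ, 0 < n → q ^ n ≠ 1) (ht : t ≠ 0)
    (E F K Ki : Module.End ℂ V)
    (hK : K * Ki = 1) (hKi : Ki * K = 1)
    (hKE : K * E = (q ^ 2) • (E * K)) (hKF : K * F = (q ^ 2)⁻¹ • (F * K))
    (hEF : E * F - F * E = (q - q⁻¹)⁻¹ • (K - Ki))
    (v : V) (m : ℤ) (hKv : K v = q ^ m • v)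
    (M N : ℕ) (hFnil : (F ^ (M + 1)) v = 0) (hEnil : (E ^ (N + 1)) v = 0)
    (hden1 : ∀ i : ℕ, 1 ≤ i → i ≤ M → qNum q (t * q ^ (i : ℤ)) ≠ 0)
    (hden2 : ∀ i : ℕ, i ≤ N → qNum q (t * q ^ (m + i)) ≠ 0) :
    ∑ k ∈ range (M + 1),
        ((-1 : ℂ) ^ k * (t * q ^ (m - 1)) ^ k /
            (qFact q k * ∏ i ∈ range k, qNum q (t * q ^ ((i : ℤ) + 1)))) •
          (E ^ k) ((F ^ k) v)
      = (q ^ (-m) * qNum q t / qNum q (t * q ^ m)) •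
          ∑ k ∈ range (N + 1),
            ((-1 : ℂ) ^ k * (t * q⁻¹) ^ k /
                (qFact q k * ∏ i ∈ range k, qNum q (t * q ^ (m + i + 1)))) •
              (F ^ k) ((E ^ k) v) := by
  have hs := sub_inv_ne_zero_of_generic hq0 hq
  obtain ⟨hCE, hCF⟩ := qCasimir_commute hq0 hK hKi hKE hKF hEF
  set Z := qCasimir q E F K Ki with hZ
  have hwE (k : ℕ) : K ((E ^ k) v) = q ^ (m + 2 * 1 * k) • (E ^ k) v :=
    weight_raise hq0 (by simpa using hKE) hKv k
  have hwF (k : ℕ) : K ((F ^ k) v) = q ^ (m + 2 * (-1) * k) • (F ^ k) v :=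
    weight_raise hq0 (by simpa using hKF) hKv k
  have hFE (k : ℕ) : (F ^ k) ((E ^ k) v) = Polynomial.aeval Z (casimirPoly q m 1 k) v :=
    pow_pow_apply_eq_aeval hCF (fun k => by
      rw [hZ, qCasimir_apply_weight hq0 hKi (hwE k)]
      ring_nf) k
  have hEF' (k : ℕ) : (E ^ k) ((F ^ k) v) = Polynomial.aeval Z (casimirPoly q m (-1) k) v :=
    pow_pow_apply_eq_aeval hCE (fun k => by
      rw [hZ, qCasimir_apply_weight' hq0 hs hKi hEF (hwF k)]
      ring_nf) k
  have hP : Polynomial.aeval Z (casimirPoly q m (-1) (M + 1)) v = 0 := by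
    rw [← hEF', hFnil, map_zero]
  have hQ : Polynomial.aeval Z (casimirPoly q m 1 (N + 1)) v = 0 := by
    rw [← hFE, hEnil, map_zero]
  simp only [hFE, hEF']
  set a : ℕ → ℂ := fun k => (-1 : ℂ) ^ k * (t * q ^ (m - 1)) ^ k /
    (qFact q k * ∏ i ∈ range k, qNum q (t * q ^ ((i : ℤ) + 1))) with ha
  set b : ℕ → ℂ := fun k => (-1 : ℂ) ^ k * (t * q⁻¹) ^ k /
    (qFact q k * ∏ i ∈ range k, qNum q (t * q ^ (m + i + 1))) with hb
  set κ : ℂ := q ^ (-m) * qNum q t / qNum q (t * q ^ m) with hκ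
  set D : Polynomial ℂ := ∑ k ∈ range (M + 1), a k • casimirPoly q m (-1) k -
    κ • ∑ k ∈ range (N + 1), b k • casimirPoly q m 1 k with hD
  suffices h : Polynomial.aeval Z D v = 0 by
    rw [hD] at h
    simpa [LinearMap.sum_apply, sub_eq_zero] using h
  have hroot : ∀ r, (casimirPoly q m (-1) (M + 1)).IsRoot r →
      (casimirPoly q m 1 (N + 1)).IsRoot r → D.IsRoot r := by
    intro r hr1 hr2
    obtain ⟨n, hn, hrn⟩ := (casimirPoly_isRoot_iff ..).1 hr1
    obtain ⟨j, hj, rfl⟩ := (casimirPoly_isRoot_iff ..).1 hr2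
    obtain rfl : m = (n : ℤ) - j := by
      rcases casimirValue_eq_iff hq0 hq hrn with h | h <;> omega
    have hr : casimirValue q ((n : ℤ) - j + 1 * (2 * j + 1)) =
        casimirValue q ((n : ℤ) + j + 1) := by ring_nf
    have hA (k : ℕ) : a k * (casimirPoly q ((n : ℤ) - j) (-1) k).eval
        (casimirValue q ((n : ℤ) + j + 1)) = qVandermondeTerm q (q ^ (j + 1)) (t * q) n k := by
      simp only [ha, qVandermondeTerm, casimirPoly, Polynomial.eval_prod,
        Polynomial.eval_sub, Polynomial.eval_X, Polynomial.eval_C]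
      congr 1
      · congr 2
        · congr 1
          rw [zpow_sub₀ hq0, zpow_sub₀ hq0, zpow_sub₀ hq0]
          simp only [zpow_natCast, zpow_one, pow_succ]
          field_simp
        · refine prod_congr rfl fun i _ => ?_
          rw [zpow_add₀ hq0, zpow_natCast, zpow_one]
          ring_nf
      · refine prod_congr rfl fun l _ => ?_
        have := casimirValue_add_sub hq0 ((n : ℤ) - l) ((j : ℤ) + l + 1)
        rw [← pow_add, ← zpow_natCast q (j + 1 + l)]
        convert this using 3 <;> push_cast <;> ring_nf
    have hB (k : ℕ) : b k * (casimirPoly q ((n : ℤ) - j) 1 k).eval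
        (casimirValue q ((n : ℤ) + j + 1)) =
        qVandermondeTerm q (q ^ (n + 1)) (t * q ^ ((n : ℤ) - j) * q) j k := by
      simp only [hb, qVandermondeTerm, casimirPoly, Polynomial.eval_prod,
        Polynomial.eval_sub, Polynomial.eval_X, Polynomial.eval_C]
      congr 1
      · congr 2
        · congr 1
          rw [zpow_sub₀ hq0, zpow_sub₀ hq0]
          simp only [zpow_natCast, zpow_one, pow_succ]
          field_simp
        · refine prod_congr rfl fun i _ => ?_
          rw [zpow_add₀ hq0, zpow_add₀ hq0, zpow_natCast, zpow_one]
          ring_nf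
      · refine prod_congr rfl fun l _ => ?_
        have := casimirValue_add_sub hq0 ((j : ℤ) - l) ((n : ℤ) + l + 1)
        rw [← casimirValue_neg q ((j : ℤ) - l - _)] at this
        rw [← pow_add, ← zpow_natCast q (n + 1 + l)]
        convert this using 3 <;> push_cast <;> ring_nf
    have hmain := sum_qVandermondeTerm_swap hq0 hq ht n j
      (fun i hi => by
        have := hden1 (i + 1) (by omega) (by omega)
        rwa [zpow_natCast, pow_succ', ← mul_assoc] at this)
      (fun i hi => by
        have := hden2 i (by omega)
        rwa [zpow_add₀ hq0, zpow_natCast, ← mul_assoc] at this)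
    have hext (β γ : ℂ) {p R : ℕ} (hp : p < R) :
        ∑ k ∈ range R, qVandermondeTerm q β γ p k =
          ∑ k ∈ range (p + 1), qVandermondeTerm q β γ p k := by
      refine (sum_subset (range_subset_range.2 hp) fun k _ hk => ?_).symm
      exact qVandermondeTerm_eq_zero q β γ (by simpa using hk)
    rw [hr, Polynomial.IsRoot, hD]
    simp only [Polynomial.eval_sub, Polynomial.eval_smul, Polynomial.eval_finsetSum,
      smul_eq_mul, hA, hB]
    rw [hext _ _ hn, hext _ _ hj, hmain, sub_self]
  rcases le_total 0 m with hm | hm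
  · exact aeval_apply_eq_zero_of_common_roots Z v _ _ D (casimirPoly_ne_zero q m 1 (N + 1))
      (casimirPoly_roots_nodup hq0 hq (Or.inl ⟨rfl, hm⟩) _) hP hQ hroot
  · exact aeval_apply_eq_zero_of_common_roots Z v _ _ D (casimirPoly_ne_zero q m (-1) (M + 1))
      (casimirPoly_roots_nodup hq0 hq (Or.inr ⟨rfl, hm⟩) _) hQ hP
      fun r h1 h2 => hroot r h2 h1
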